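/- Fix a positive integer p, u = u₀ + iu₁ ∈ ℂ with u₀ = Re(u) < 1, and complex coefficients (b_m)_{m ∈ ℤ∖{0}} of at most polynomial growth. Let ε > 0 and suppose there exists C₀ > 0 such that Σ_{0 < |m| ≤ pk} |m/p|^{ε/2 − 1 − u₀} |b_m|² ≤ C₀ k^{ε/2} for every real k > 1. Then there is a constant C > 0 such that for every a₁ > 0 and every continuous rapidly decreasing ψ : ℝ → ℂ, with f_ψ(a,t) = a^{−1−u} Σ_{m ≠ 0} ψ(−(m/p) a^{−2}) b_m e^{−2πi t m/p}: ∫₀^{a₁} ∫₀^{p} |f_ψ(a,t)|² dt a^{ε} da/a ≤ C a₁^{ε} Σ_{σ ∈ {+1,−1}} ∫_{1/(a₁² p)}^{∞} a^{u₀} |ψ(σ a)|² da. -/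

import Mathlib

open MeasureTheory Real Set
open scoped ENNReal NNReal

noncomputable section

/-- `ψ : ℝ → ℂ` is rapidly decreasing: `sup_x (1+|x|)^k ‖ψ x‖ < ∞` for every `k`. -/
def RapidDecay (ψ : ℝ → ℂ) : Prop :=
  ∀ k : ℕ, ∃ C : ℝ, ∀ x : ℝ, (1 + |x|) ^ k * ‖ψ x‖ ≤ C

/-- Coefficients `(b_m)` of at most polynomial growth. -/
def PolyGrowth (b : ℤ → ℂ) : Prop :=
  ∃ C N : ℝ, ∀ m : ℤ, ‖b m‖ ≤ C * (1 + |(m : ℝ)|) ^ N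

/-- The Fourier–Whittaker series
`f_ψ(a,t) = a^{−1−u} Σ_{m ≠ 0} ψ(−(m/p) a^{−2}) b_m e^{−2πi t m/p}`
(the `m = 0` term vanishes since `b 0 = 0` in all statements below). -/
def fW (p : ℕ) (u : ℂ) (b : ℤ → ℂ) (ψ : ℝ → ℂ) (a t : ℝ) : ℂ :=
  (a : ℂ) ^ (-1 - u) *
    ∑' m : ℤ, ψ (-((m : ℝ) / (p : ℝ)) * a ^ (-2 : ℤ)) * b m *
      Complex.exp (-2 * (π : ℂ) * Complex.I * (t : ℂ) * (m : ℂ) / (p : ℂ))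

/-- The weighted `L²`-norm `∫_s ∫₀^p |f_ψ(a,t)|² dt a^ε da/a` over a set `s` of `a`'s. -/
def lhsInt (p : ℕ) (u : ℂ) (b : ℤ → ℂ) (ψ : ℝ → ℂ) (ε : ℝ) (s : Set ℝ) : ℝ≥0∞ :=
  ∫⁻ a in s,
    (∫⁻ t in Ioc (0:ℝ) (p : ℝ), (‖fW p u b ψ a t‖₊ : ℝ≥0∞) ^ 2) *
      ENNReal.ofReal (a ^ ε) * ENNReal.ofReal a⁻¹

/-- Parseval's identity for an absolutely convergent Fourier series. -/
theorem lintegral_tsum_fourier_sq {T : ℝ} [hT : Fact (0 < T)] {c : ℤ → ℂ} (hc : Summable c) :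
    ∫⁻ x : AddCircle T, ‖∑' m : ℤ, c m * fourier m x‖ₑ ^ 2 ∂AddCircle.haarAddCircle
      = ∑' m : ℤ, ‖c m‖ₑ ^ 2 := by
  have hs : Summable fun m : ℤ => c m • (fourier m : C(AddCircle T, ℂ)) :=
    Summable.of_norm (by simpa [norm_smul, fourier_norm] using hc.norm)
  set F : C(AddCircle T, ℂ) := ∑' m : ℤ, c m • fourier m with hF
  have hFx (x : AddCircle T) : ∑' m : ℤ, c m * fourier m x = F x :=
    (ContinuousMap.hasSum_apply hs.hasSum x).tsum_eq
  have hsum : HasSum (fun m : ℤ => c m • fourierLp (T := T) 2 m)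
      (ContinuousMap.toLp 2 AddCircle.haarAddCircle ℂ F) := by
    simpa [Function.comp_def, fourierLp] using
      hs.hasSum.mapL (ContinuousMap.toLp 2 AddCircle.haarAddCircle ℂ)
  have hcoeff (m : ℤ) :
      fourierCoeff (ContinuousMap.toLp (E := ℂ) 2 AddCircle.haarAddCircle ℂ F) m = c m := by
    rw [← fourierBasis_repr, HilbertBasis.repr_apply_apply, coe_fourierBasis]
    have h := hsum.mapL (innerSL ℂ (fourierLp (T := T) 2 m))
    refine h.unique ?_
    have ho := orthonormal_iff_ite.mp (orthonormal_fourier (T := T)) m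
    simp only [map_smul, innerSL_apply_apply, ho, smul_eq_mul, mul_ite, mul_one, mul_zero]
    simpa using hasSum_single (f := fun n => if m = n then c n else 0) m fun n hn => if_neg hn.symm
  have hpars := hasSum_sq_fourierCoeff (ContinuousMap.toLp (E := ℂ) 2 AddCircle.haarAddCircle ℂ F)
  simp only [hcoeff] at hpars
  have hint : ∫ t : AddCircle T, ‖ContinuousMap.toLp (E := ℂ) 2 AddCircle.haarAddCircle ℂ F t‖ ^ 2
      ∂AddCircle.haarAddCircle = ∫ t : AddCircle T, ‖F t‖ ^ 2 ∂AddCircle.haarAddCircle := by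
    refine integral_congr_ae ?_
    filter_upwards [ContinuousMap.coeFn_toLp (E := ℂ) (p := 2) AddCircle.haarAddCircle (𝕜 := ℂ) F]
      with x hx
    rw [hx]
  rw [hint] at hpars
  have hcont : Continuous fun t : AddCircle T => ‖F t‖ ^ 2 := by fun_prop
  have hFint : Integrable (fun t : AddCircle T => ‖F t‖ ^ 2) AddCircle.haarAddCircle :=
    hcont.integrable_of_hasCompactSupport (HasCompactSupport.of_compactSpace _)
  have hsq (z : ℂ) : ‖z‖ₑ ^ 2 = ENNReal.ofReal (‖z‖ ^ 2) := by
    rw [← ofReal_norm, ENNReal.ofReal_pow (norm_nonneg z)]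
  simp only [hFx, hsq]
  rw [← ofReal_integral_eq_lintegral_ofReal hFint (by filter_upwards with x; positivity),
    ← hpars.tsum_eq, ENNReal.ofReal_tsum_of_nonneg (fun m => by positivity) hpars.summable]

/-- Bessel's inequality on `(0, T]` for a Fourier series, with no summability assumption: a series that
does not converge absolutely has junk value `0`. -/
theorem lintegral_tsum_exp_sq_le {T : ℝ} (hT : 0 < T) (c : ℤ → ℂ) :
    ∫⁻ t in Ioc 0 T, (‖∑' m : ℤ, c m *
        Complex.exp (-2 * (π : ℂ) * Complex.I * (t : ℂ) * (m : ℂ) / (T : ℂ))‖₊ : ℝ≥0∞) ^ 2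
      ≤ ENNReal.ofReal T * ∑' m : ℤ, (‖c m‖₊ : ℝ≥0∞) ^ 2 := by
  have : Fact (0 < T) := ⟨hT⟩
  have hexp (m : ℤ) (t : ℝ) :
      Complex.exp (-2 * (π : ℂ) * Complex.I * (t : ℂ) * (m : ℂ) / (T : ℂ))
        = fourier (-m) (t : AddCircle T) := by
    rw [fourier_coe_apply]
    congr 1
    push_cast
    ring
  by_cases hc : Summable c
  · have hneg : Summable fun m => c (-m) := (Equiv.neg ℤ).summable_iff.mpr hc
    have hre (t : ℝ) : ∑' m : ℤ, c m *
        Complex.exp (-2 * (π : ℂ) * Complex.I * (t : ℂ) * (m : ℂ) / (T : ℂ))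
          = ∑' m : ℤ, c (-m) * fourier m (t : AddCircle T) := by
      rw [← (Equiv.neg ℤ).tsum_eq]
      simp only [hexp, Equiv.neg_apply, neg_neg]
    have hpre := AddCircle.lintegral_preimage T 0
      (fun x => ‖∑' m : ℤ, c (-m) * fourier m x‖ₑ ^ 2)
    rw [zero_add, AddCircle.volume_eq_smul_haarAddCircle, lintegral_smul_measure,
      lintegral_tsum_fourier_sq hneg,
      show ∑' m : ℤ, ‖c (-m)‖ₑ ^ 2 = ∑' m : ℤ, ‖c m‖ₑ ^ 2 from
        (Equiv.neg ℤ).tsum_eq (fun m => ‖c m‖ₑ ^ 2)] at hpre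
    simp only [hre]
    exact hpre.le
  · have h0 (t : ℝ) : ∑' m : ℤ, c m *
        Complex.exp (-2 * (π : ℂ) * Complex.I * (t : ℂ) * (m : ℂ) / (T : ℂ)) = 0 := by
      refine tsum_eq_zero_of_not_summable fun h => hc ?_
      rw [← summable_norm_iff] at h ⊢
      refine h.congr fun m => ?_
      rw [hexp, norm_mul, fourier_apply, Circle.norm_coe, mul_one]
    simp only [h0]
    simp

/-- The change of variables `x = r a⁻²`. -/
theorem setLIntegral_comp_mul_inv_sq_le {r : ℝ} (hr : 0 < r) (A s : ℝ)
    (g : ℝ → ℝ≥0∞) :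
    ∫⁻ a in Ioc 0 A, ENNReal.ofReal (a ^ (-3 - 2 * s)) * g (r * a ^ (-2 : ℤ))
      ≤ ENNReal.ofReal (r ^ (-1 - s) / 2) *
        ∫⁻ x in Ici (r / A ^ 2), ENNReal.ofReal (x ^ s) * g x := by
  set f : ℝ → ℝ := fun a => r * a ^ (-2 : ℤ) with hf
  have hderiv : ∀ a ∈ Ioc 0 A, HasDerivWithinAt f (r * (-2 * a ^ (-3 : ℤ))) (Ioc 0 A) a := by
    intro a ha
    have h := (hasDerivAt_zpow (-2) a (Or.inl ha.1.ne')).const_mul r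
    exact (h.congr_deriv (by norm_num) : HasDerivAt f (r * (-2 * a ^ (-3 : ℤ))) a).hasDerivWithinAt
  have hinj : InjOn f (Ioc 0 A) := by
    intro a ha b hb hab
    have h := mul_left_cancel₀ hr.ne' hab
    rw [zpow_neg, zpow_neg, inv_inj] at h
    exact (pow_left_inj₀ ha.1.le hb.1.le two_ne_zero).mp (by exact_mod_cast h)
  have himg : f '' Ioc 0 A ⊆ Ici (r / A ^ 2) := by
    rintro _ ⟨a, ha, rfl⟩
    have ha0 := ha.1
    have h : a ^ 2 ≤ A ^ 2 := pow_le_pow_left₀ ha.1.le ha.2 2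
    simp only [hf, mem_Ici, zpow_neg, div_eq_mul_inv]
    gcongr
    exact_mod_cast h
  calc _ = ENNReal.ofReal (r ^ (-1 - s) / 2) *
        ∫⁻ x in f '' Ioc 0 A, ENNReal.ofReal (x ^ s) * g x := by
        rw [lintegral_image_eq_lintegral_abs_deriv_mul measurableSet_Ioc hderiv hinj,
          ← lintegral_const_mul' _ _ ENNReal.ofReal_ne_top]
        refine setLIntegral_congr_fun measurableSet_Ioc fun a ha => ?_
        have ha0 := ha.1
        have habs : |r * (-2 * a ^ (-3 : ℤ))| = 2 * r * a ^ (-3 : ℝ) := by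
          rw [← rpow_intCast, abs_mul, abs_mul, abs_of_pos hr, abs_of_pos (rpow_pos_of_pos ha0 _)]
          norm_num
          ring
        simp only [hf]
        rw [← mul_assoc, ← mul_assoc, habs, ← ENNReal.ofReal_mul (by positivity),
          ← ENNReal.ofReal_mul (by positivity)]
        congr 2
        rw [mul_rpow hr.le (by positivity), ← rpow_intCast, ← rpow_mul ha0.le]
        have h1 : a ^ (-3 - 2 * s) = a ^ (-3 : ℝ) * a ^ ((-2 : ℤ) * s) := by
          rw [← rpow_add ha0]; congr 1; push_cast; ring
        have h2 : r ^ (-1 - s) * r * r ^ s = 1 := by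
          nth_rewrite 2 [← rpow_one r]
          rw [← rpow_add hr, ← rpow_add hr, show -1 - s + 1 + s = 0 by ring, rpow_zero]
        rw [h1]
        linear_combination (-(a ^ (-3 : ℝ) * a ^ ((-2 : ℤ) * s))) * h2
    _ ≤ _ := by gcongr

/-- Bessel's inequality for `fW` at fixed height `a`, symmetrized in the sign of `m`. -/
theorem lintegral_fW_sq_le {p : ℕ} (hp : 0 < p) (u : ℂ) (b : ℤ → ℂ) (ψ : ℝ → ℂ) {a : ℝ}
    (ha : 0 < a) :
    ∫⁻ t in Ioc (0 : ℝ) (p : ℝ), (‖fW p u b ψ a t‖₊ : ℝ≥0∞) ^ 2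
      ≤ ENNReal.ofReal (a ^ (-2 - 2 * u.re)) * (ENNReal.ofReal p * ∑' m : ℤ,
        (‖b m‖₊ : ℝ≥0∞) ^ 2 * ((‖ψ (|(m : ℝ) / p| * a ^ (-2 : ℤ))‖₊ : ℝ≥0∞) ^ 2
          + (‖ψ (-(|(m : ℝ) / p| * a ^ (-2 : ℤ)))‖₊ : ℝ≥0∞) ^ 2)) := by
  have hpow : (‖(a : ℂ) ^ (-1 - u)‖₊ : ℝ≥0∞) ^ 2 = ENNReal.ofReal (a ^ (-2 - 2 * u.re)) := by
    rw [← enorm_eq_nnnorm, ← ofReal_norm, Complex.norm_cpow_eq_rpow_re_of_pos ha,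
      ← ENNReal.ofReal_pow (by positivity), ← rpow_natCast, ← rpow_mul ha.le]
    congr 2
    simp
    ring
  have hfW (t : ℝ) : (‖fW p u b ψ a t‖₊ : ℝ≥0∞) ^ 2 = ENNReal.ofReal (a ^ (-2 - 2 * u.re)) *
      (‖∑' m : ℤ, ψ (-((m : ℝ) / (p : ℝ)) * a ^ (-2 : ℤ)) * b m *
        Complex.exp (-2 * (π : ℂ) * Complex.I * (t : ℂ) * (m : ℂ) / ((p : ℝ) : ℂ))‖₊ : ℝ≥0∞) ^ 2 := by
    rw [fW, nnnorm_mul, ENNReal.coe_mul, mul_pow, hpow, Complex.ofReal_natCast]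
  simp only [hfW]
  rw [lintegral_const_mul' _ _ ENNReal.ofReal_ne_top]
  gcongr
  refine (lintegral_tsum_exp_sq_le (Nat.cast_pos.mpr hp) _).trans ?_
  gcongr with m
  rw [nnnorm_mul, ENNReal.coe_mul, mul_pow, mul_comm]
  gcongr
  rcases abs_choice ((m : ℝ) / p) with h | h <;> rw [h]
  · rw [neg_mul]
    exact le_add_self
  · exact le_self_add

/-- A growth bound on the partial sums for `k > 1` extends to `k > 1 / p`, the range where the sum may be
nonzero, by monotonicity. -/
theorem tsum_le_of_inv_lt {w : ℤ → ℝ≥0∞} {p : ℕ} (hp : 0 < p) {C₀ δ : ℝ}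
    (hsum : ∀ k : ℝ, 1 < k →
      (∑' m : ℤ, if m ≠ 0 ∧ |(m : ℝ)| ≤ (p : ℝ) * k then w m else 0)
        ≤ ENNReal.ofReal (C₀ * k ^ δ)) {k : ℝ} (hk : 1 < p * k) :
    (∑' m : ℤ, if m ≠ 0 ∧ |(m : ℝ)| ≤ (p : ℝ) * k then w m else 0)
      ≤ ENNReal.ofReal (C₀ * (p * k) ^ δ) := by
  have hp1 : (1 : ℝ) ≤ p := by exact_mod_cast hp
  refine le_trans (ENNReal.tsum_le_tsum fun m => ?_) (hsum (p * k) hk)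
  split_ifs with h1 h2
  · exact le_rfl
  · exact absurd ⟨h1.1, h1.2.trans (le_mul_of_one_le_left (by linarith) hp1)⟩ h2
  · exact zero_le
  · exact le_rfl

/-- if `ε > 0` and `Σ_{0<|m|≤pk} |m/p|^{ε/2−1−u₀} |b_m|² ≤ C₀ k^{ε/2}` for
all real `k > 1`, then there is `C > 0` such that for all `a₁ > 0` and all continuous
rapidly decreasing `ψ`,
`∫₀^{a₁} ∫₀^p |f_ψ|² dt a^ε da/a ≤ C a₁^ε Σ_{σ=±1} ∫_{1/(a₁²p)}^∞ a^{u₀} |ψ(σa)|² da`. -/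
theorem stmt10 (p : ℕ) (hp : 0 < p) (u : ℂ) (hu : u.re < 1)
    (b : ℤ → ℂ) (hb0 : b 0 = 0) (hb : PolyGrowth b) (ε : ℝ) (hε : 0 < ε)
    (C₀ : ℝ) (hC₀ : 0 < C₀)
    (hsum : ∀ k : ℝ, 1 < k →
      (∑' m : ℤ, if m ≠ 0 ∧ |(m : ℝ)| ≤ (p : ℝ) * k then
          ENNReal.ofReal (|(m : ℝ) / (p : ℝ)| ^ (ε / 2 - 1 - u.re)) *
            (‖b m‖₊ : ℝ≥0∞) ^ 2
        else 0)
        ≤ ENNReal.ofReal (C₀ * k ^ (ε / 2))) :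
    ∃ C : ℝ, 0 < C ∧
      ∀ a₁ : ℝ, 0 < a₁ → ∀ ψ : ℝ → ℂ, Continuous ψ → RapidDecay ψ →
        lhsInt p u b ψ ε (Ioc (0:ℝ) a₁)
          ≤ ENNReal.ofReal (C * a₁ ^ ε) *
              ((∫⁻ a in Ioi (1 / (a₁ ^ 2 * (p : ℝ))),
                  ENNReal.ofReal (a ^ u.re) * (‖ψ a‖₊ : ℝ≥0∞) ^ 2)
                + (∫⁻ a in Ioi (1 / (a₁ ^ 2 * (p : ℝ))),
                    ENNReal.ofReal (a ^ u.re) * (‖ψ (-a)‖₊ : ℝ≥0∞) ^ 2)) := by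
  set s : ℝ := u.re - ε / 2 with hs
  have hp0 : (0 : ℝ) < p := Nat.cast_pos.mpr hp
  refine ⟨C₀ * (p : ℝ) ^ (ε / 2) * (p / 2), by positivity, fun a₁ ha₁ ψ hψ _ => ?_⟩
  set G : ℝ → ℝ≥0∞ := fun x => (‖ψ x‖₊ : ℝ≥0∞) ^ 2 + (‖ψ (-x)‖₊ : ℝ≥0∞) ^ 2 with hG
  have hGm : Measurable G := by
    have := hψ.measurable
    fun_prop
  set r : ℤ → ℝ := fun m => |(m : ℝ) / p| with hr
  set L : ℝ := 1 / (a₁ ^ 2 * (p : ℝ)) with hL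
  set w : ℤ → ℝ≥0∞ := fun m => ENNReal.ofReal (|(m : ℝ) / (p : ℝ)| ^ (ε / 2 - 1 - u.re)) *
    (‖b m‖₊ : ℝ≥0∞) ^ 2 with hw
  have hLpos : 0 < L := by positivity
  have hterm (m : ℤ) :
      ∫⁻ a in Ioc 0 a₁, ENNReal.ofReal p * (‖b m‖₊ : ℝ≥0∞) ^ 2 *
          (ENNReal.ofReal (a ^ (-3 - 2 * s)) * G (r m * a ^ (-2 : ℤ)))
        ≤ ∫⁻ x in Ioi L, (if m ≠ 0 ∧ |(m : ℝ)| ≤ (p : ℝ) * (a₁ ^ 2 * x) then w m else 0) *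
          (ENNReal.ofReal (p / 2) * (ENNReal.ofReal (x ^ s) * G x)) := by
    rcases eq_or_ne m 0 with rfl | hm
    · simp [hb0]
    have hrm : 0 < r m := by positivity
    have hLR : L ≤ r m / a₁ ^ 2 := by
      have h1 : (1 : ℝ) ≤ |(m : ℝ)| := by exact_mod_cast Int.one_le_abs hm
      rw [hL, mul_comm, ← div_div]
      simp only [hr]
      rw [abs_div, abs_of_pos hp0]
      gcongr
    have hiff (x : ℝ) : |(m : ℝ)| ≤ (p : ℝ) * (a₁ ^ 2 * x) ↔ x ∈ Ici (r m / a₁ ^ 2) := by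
      rw [mem_Ici, div_le_iff₀ (by positivity)]
      simp only [hr]
      rw [abs_div, abs_of_pos hp0, div_le_iff₀ hp0]
      ring_nf
    have hwm : w m * ENNReal.ofReal (p / 2)
        = ENNReal.ofReal p * (‖b m‖₊ : ℝ≥0∞) ^ 2 * ENNReal.ofReal (r m ^ (-1 - s) / 2) := by
      simp only [hw]
      rw [mul_right_comm, mul_right_comm (ENNReal.ofReal (p : ℝ)),
        ← ENNReal.ofReal_mul (by positivity), ← ENNReal.ofReal_mul hp0.le]
      congr 2
      rw [show -1 - s = ε / 2 - 1 - u.re by rw [hs]; ring]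
      ring
    rw [lintegral_const_mul' _ _ (by finiteness)]
    calc _ ≤ ENNReal.ofReal p * (‖b m‖₊ : ℝ≥0∞) ^ 2 * (ENNReal.ofReal (r m ^ (-1 - s) / 2) *
          ∫⁻ x in Ici (r m / a₁ ^ 2), ENNReal.ofReal (x ^ s) * G x) := by
          gcongr
          exact setLIntegral_comp_mul_inv_sq_le hrm a₁ s G
      _ = ∫⁻ x in Ici (r m / a₁ ^ 2), w m *
          (ENNReal.ofReal (p / 2) * (ENNReal.ofReal (x ^ s) * G x)) := by
          simp only [← mul_assoc (w m)]
          rw [lintegral_const_mul' _ _ (by finiteness), hwm]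
          simp only [mul_assoc]
      _ = ∫⁻ x in Ici L, (Ici (r m / a₁ ^ 2)).indicator (fun x => w m *
          (ENNReal.ofReal (p / 2) * (ENNReal.ofReal (x ^ s) * G x))) x := by
          rw [setLIntegral_indicator measurableSet_Ici, inter_eq_left.mpr (Ici_subset_Ici.mpr hLR)]
      _ = _ := by
          rw [setLIntegral_congr Ioi_ae_eq_Ici.symm]
          refine lintegral_congr fun x => ?_
          simp only [indicator_apply, hiff, hm, ne_eq, not_false_eq_true, true_and, ite_mul,
            zero_mul]
  calc lhsInt p u b ψ ε (Ioc 0 a₁)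
      ≤ ∫⁻ a in Ioc 0 a₁, ∑' m : ℤ, ENNReal.ofReal p * (‖b m‖₊ : ℝ≥0∞) ^ 2 *
          (ENNReal.ofReal (a ^ (-3 - 2 * s)) * G (r m * a ^ (-2 : ℤ))) := by
        refine setLIntegral_mono' measurableSet_Ioc fun a ha => ?_
        have ha0 := ha.1
        have hexp : a ^ (-3 - 2 * s) = a ^ (-2 - 2 * u.re) * a ^ ε * a⁻¹ := by
          rw [← rpow_neg_one a, ← rpow_add ha0, ← rpow_add ha0, hs]
          ring_nf
        rw [hexp, ENNReal.ofReal_mul (by positivity), ENNReal.ofReal_mul (by positivity)]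
        refine (mul_le_mul_left (mul_le_mul_left (lintegral_fW_sq_le hp u b ψ ha0) _) _).trans_eq ?_
        simp only [← ENNReal.tsum_mul_left, ← ENNReal.tsum_mul_right]
        refine tsum_congr fun m => ?_
        simp only [hG, hr]
        ring
    _ = ∑' m : ℤ, ∫⁻ a in Ioc 0 a₁, ENNReal.ofReal p * (‖b m‖₊ : ℝ≥0∞) ^ 2 *
          (ENNReal.ofReal (a ^ (-3 - 2 * s)) * G (r m * a ^ (-2 : ℤ))) :=
        lintegral_tsum fun m => by fun_prop
    _ ≤ ∑' m : ℤ, ∫⁻ x in Ioi L,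
          (if m ≠ 0 ∧ |(m : ℝ)| ≤ (p : ℝ) * (a₁ ^ 2 * x) then w m else 0) *
            (ENNReal.ofReal (p / 2) * (ENNReal.ofReal (x ^ s) * G x)) :=
        ENNReal.tsum_le_tsum hterm
    _ = ∫⁻ x in Ioi L, ∑' m : ℤ,
          (if m ≠ 0 ∧ |(m : ℝ)| ≤ (p : ℝ) * (a₁ ^ 2 * x) then w m else 0) *
            (ENNReal.ofReal (p / 2) * (ENNReal.ofReal (x ^ s) * G x)) := by
        refine (lintegral_tsum fun m => Measurable.aemeasurable ?_).symm
        refine Measurable.mul (Measurable.ite ?_ measurable_const measurable_const)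
          (by fun_prop : Measurable fun x =>
            ENNReal.ofReal (p / 2) * (ENNReal.ofReal (x ^ s) * G x))
        exact (MeasurableSet.const _).inter (measurableSet_le measurable_const
          (by fun_prop : Measurable fun x : ℝ => (p : ℝ) * (a₁ ^ 2 * x)))
    _ ≤ ∫⁻ x in Ioi L, ENNReal.ofReal (C₀ * (p : ℝ) ^ (ε / 2) * (p / 2) * a₁ ^ ε) *
          (ENNReal.ofReal (x ^ u.re) * G x) := by
        refine setLIntegral_mono' measurableSet_Ioi fun x hx => ?_
        have hx0 : 0 < x := hLpos.trans hx
        have hk : 1 < p * (a₁ ^ 2 * x) := by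
          have := (div_lt_iff₀ (by positivity)).mp (mem_Ioi.mp hx)
          linarith
        rw [ENNReal.tsum_mul_right]
        refine (mul_le_mul_left (tsum_le_of_inv_lt hp hsum hk) _).trans_eq ?_
        simp only [← mul_assoc _ _ (G x)]
        rw [← ENNReal.ofReal_mul (by positivity), ← ENNReal.ofReal_mul (by positivity),
          ← ENNReal.ofReal_mul (by positivity)]
        congr 2
        have h1 : (a₁ ^ 2) ^ (ε / 2) = a₁ ^ ε := by
          rw [← rpow_natCast, ← rpow_mul ha₁.le]
          congr 1
          push_cast
          ring
        have h2 : x ^ u.re = x ^ (ε / 2) * x ^ s := by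
          rw [← rpow_add hx0, hs]
          ring_nf
        rw [mul_rpow hp0.le (by positivity), mul_rpow (by positivity) hx0.le, h1, h2]
        ring
    _ = _ := by
        rw [lintegral_const_mul' _ _ ENNReal.ofReal_ne_top]
        simp only [hG, mul_add]
        rw [lintegral_add_left (by have := hψ.measurable; fun_prop), mul_add]
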